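/- Let d ≥ 1 be an integer, α ∈ (0,2], and let the Hurst functional index H satisfy (H₁) and (H₂). There exists δ₀ > 0 such that for all 0 < ε < T with T − ε ≤ δ₀, writing I := [ε,T]^N, one has ∫_I ∫_I Φ(u,v)^{−d} du dv < ∞ if and only if condition C holds: d ≤ inf_{v∈I} ∑_{l=1}^N 1/h_l(v) and ∫_I (∑_{l=1}^N 1/h_l(v) − d)^{−1} dv < ∞. -/

import Mathlib

open MeasureTheory Finset
open scoped ENNReal

/-- `(a₊)^c` with the convention `0^c := 0` for every real exponent `c`. -/
noncomputable def ppow (a c : ℝ) : ℝ := if 0 < a then a ^ c else 0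

/-- The multifractional kernel `g^{H(u)}(u,w)`. -/
noncomputable def kernelG (N : ℕ) (α : ℝ) (h : Fin N → (Fin N → ℝ) → ℝ)
    (u w : Fin N → ℝ) : ℝ :=
  ∏ l, (ppow (u l - w l) (h l u - 1 / α) - ppow (-w l) (h l u - 1 / α))

/-- The `α`-increment (quasi)norm
`Φ(u,v) = (∫_{ℝ^N} |g^{H(u)}(u,w) - g^{H(v)}(v,w)|^α dw)^{1/α}`, valued in `[0,∞]`. -/
noncomputable def PhiNorm (N : ℕ) (α : ℝ) (h : Fin N → (Fin N → ℝ) → ℝ)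
    (u v : Fin N → ℝ) : ℝ≥0∞ :=
  (∫⁻ w : Fin N → ℝ,
    ENNReal.ofReal (|kernelG N α h u w - kernelG N α h v w| ^ α)) ^ (1 / α)

lemma lintegral_Ioo_rpow {c e : ℝ} (hc : 0 < c) (he : 0 < e) :
    ∫⁻ x in Set.Ioo 0 c, ENNReal.ofReal (x ^ (e - 1)) = ENNReal.ofReal (c ^ e / e) := by
  have hi : IntervalIntegrable (fun x : ℝ => x ^ (e - 1)) volume 0 c :=
    intervalIntegral.intervalIntegrable_rpow' (by linarith)
  have hi' : IntegrableOn (fun x : ℝ => x ^ (e - 1)) (Set.Ioo 0 c) :=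
    ((intervalIntegrable_iff_integrableOn_Ioc_of_le hc.le).1 hi).mono_set Set.Ioo_subset_Ioc_self
  rw [← ofReal_integral_eq_lintegral_ofReal hi']
  · rw [← integral_Ioc_eq_integral_Ioo, ← intervalIntegral.integral_of_le hc.le,
      integral_rpow (Or.inl (by linarith))]
    simp [Real.zero_rpow he.ne']
  · filter_upwards [ae_restrict_mem measurableSet_Ioo] with x hx
    exact Real.rpow_nonneg hx.1.le _

lemma lintegral_Ioi_rpow {c e : ℝ} (hc : 0 < c) (he : 0 < e) :
    ∫⁻ x in Set.Ioi c, ENNReal.ofReal (x ^ (-e - 1)) = ENNReal.ofReal (c ^ (-e) / e) := by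
  rw [← ofReal_integral_eq_lintegral_ofReal
    (integrableOn_Ioi_rpow_of_lt (by linarith : -e - 1 < -1) hc)]
  · rw [integral_Ioi_rpow_of_lt (by linarith) hc]
    simp [neg_div_neg_eq]
  · filter_upwards [ae_restrict_mem measurableSet_Ioi] with x hx
    exact Real.rpow_nonneg (hc.trans hx).le _

lemma abs_add_rpow_le {α : ℝ} (hα : 0 < α) (x y : ℝ) :
    |x + y| ^ α ≤ 2 ^ α * (|x| ^ α + |y| ^ α) := by
  have h1 : |x + y| ≤ 2 * max |x| |y| := by
    have := abs_add_le x y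
    have := le_max_left |x| |y|
    have := le_max_right |x| |y|
    linarith
  have hm : (0 : ℝ) ≤ max |x| |y| := (abs_nonneg x).trans (le_max_left _ _)
  calc |x + y| ^ α ≤ (2 * max |x| |y|) ^ α := Real.rpow_le_rpow (abs_nonneg _) h1 hα.le
    _ = 2 ^ α * (max |x| |y|) ^ α := Real.mul_rpow (by norm_num) hm
    _ ≤ 2 ^ α * (|x| ^ α + |y| ^ α) := by
      gcongr
      have h2 := Real.rpow_nonneg (abs_nonneg x) α
      have h3 := Real.rpow_nonneg (abs_nonneg y) α
      rcases max_choice |x| |y| with h | h <;> rw [h] <;> linarith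

lemma lintegral_increment_le {α β γ a s A : ℝ} (hα : 0 < α) (hβ : 0 < β) (hγ : γ < 1)
    (ha : 0 < a) (hs : 0 < s) (hA : 0 ≤ A) {q : ℝ → ℝ} (hq0 : ∀ x ≤ 0, q x = 0)
    (hq : ∀ x, 0 < x → x < a + s → |q x| ≤ A * x ^ (β - 1 / α))
    (hinc : ∀ x, s ≤ x → |q (x + a) - q x| ≤ A * (a * x ^ (γ - 1 / α - 1))) :
    ∫⁻ w, ENNReal.ofReal (|q (a - w) - q (-w)| ^ α) ≤
      ENNReal.ofReal (A ^ α * (2 ^ α * ((a + s) ^ (α * β) / (α * β) + s ^ (α * β) / (α * β)) +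
        a ^ α * (s ^ (-(α * (1 - γ))) / (α * (1 - γ))))) := by
  set φ : ℝ → ℝ → ℝ≥0∞ := fun c =>
    (Set.Ioo 0 c).indicator fun x => ENNReal.ofReal (x ^ (α * β - 1)) with hφ
  set ψ : ℝ → ℝ≥0∞ :=
    (Set.Ioi s).indicator fun x => ENNReal.ofReal (x ^ (-(α * (1 - γ)) - 1)) with hψ
  have hφm : ∀ c, Measurable (φ c) := fun c =>
    Measurable.indicator (by fun_prop) measurableSet_Ioo
  have hψm : Measurable ψ := Measurable.indicator (by fun_prop) measurableSet_Ioi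
  have hAα : 0 ≤ A ^ α := Real.rpow_nonneg hA _
  have hqφ : ∀ c, c ≤ a + s → ∀ x, x < c →
      ENNReal.ofReal (|q x| ^ α) ≤ ENNReal.ofReal (A ^ α) * φ c x := by
    intro c hc x hx
    rcases le_or_gt x 0 with h0 | h0
    · simp [hq0 x h0, Real.zero_rpow hα.ne']
    · rw [hφ]
      simp only
      rw [Set.indicator_of_mem (show x ∈ Set.Ioo 0 c from ⟨h0, hx⟩), ← ENNReal.ofReal_mul hAα]
      apply ENNReal.ofReal_le_ofReal
      calc |q x| ^ α ≤ (A * x ^ (β - 1 / α)) ^ α :=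
            Real.rpow_le_rpow (abs_nonneg _) (hq x h0 (hx.trans_le hc)) hα.le
        _ = A ^ α * x ^ (α * β - 1) := by
            rw [Real.mul_rpow hA (Real.rpow_nonneg h0.le _), ← Real.rpow_mul h0.le]
            congr 2; field_simp
  have hpt : ∀ w, w ≠ -s → ENNReal.ofReal (|q (a - w) - q (-w)| ^ α) ≤
      ENNReal.ofReal (A ^ α) * (ENNReal.ofReal (2 ^ α) * (φ (a + s) (a - w) + φ s (-w)) +
        ENNReal.ofReal (a ^ α) * ψ (-w)) := by
    intro w hw
    rcases lt_or_gt_of_ne hw with h1 | h1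
    · refine le_trans ?_ (mul_le_mul_right le_add_self _)
      rw [hψ, Set.indicator_of_mem (show -w ∈ Set.Ioi s from by simp; linarith),
        ← ENNReal.ofReal_mul (by positivity), ← ENNReal.ofReal_mul hAα]
      apply ENNReal.ofReal_le_ofReal
      have hw0 : 0 < -w := by linarith
      have := hinc (-w) (by linarith)
      rw [show -w + a = a - w by ring] at this
      calc |q (a - w) - q (-w)| ^ α ≤ (A * (a * (-w) ^ (γ - 1 / α - 1))) ^ α :=
            Real.rpow_le_rpow (abs_nonneg _) this hα.le
        _ = A ^ α * (a ^ α * (-w) ^ (-(α * (1 - γ)) - 1)) := by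
            rw [Real.mul_rpow hA (by positivity),
              Real.mul_rpow ha.le (Real.rpow_nonneg hw0.le _), ← Real.rpow_mul hw0.le]
            congr 3; field_simp; ring
    · refine le_trans ?_ (mul_le_mul_right le_self_add _)
      have e1 := hqφ (a + s) le_rfl (a - w) (by linarith)
      have e2 := hqφ s (by linarith) (-w) (by linarith)
      calc ENNReal.ofReal (|q (a - w) - q (-w)| ^ α)
          ≤ ENNReal.ofReal (2 ^ α * (|q (a - w)| ^ α + |q (-w)| ^ α)) := by
            apply ENNReal.ofReal_le_ofReal
            have := abs_add_rpow_le hα (q (a - w)) (-q (-w))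
            rwa [abs_neg, ← sub_eq_add_neg] at this
        _ = ENNReal.ofReal (2 ^ α) *
            (ENNReal.ofReal (|q (a - w)| ^ α) + ENNReal.ofReal (|q (-w)| ^ α)) := by
            rw [ENNReal.ofReal_mul (by positivity), ENNReal.ofReal_add (by positivity)
              (by positivity)]
        _ ≤ ENNReal.ofReal (2 ^ α) * (ENNReal.ofReal (A ^ α) * φ (a + s) (a - w) +
            ENNReal.ofReal (A ^ α) * φ s (-w)) := by gcongr
        _ = _ := by ring
  have hae : ∀ᵐ w : ℝ, w ≠ -s := by
    simp [ae_iff]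
  refine (lintegral_mono_ae (hae.mono hpt)).trans (le_of_eq ?_)
  have i1 : ∫⁻ w, φ (a + s) (a - w) = ENNReal.ofReal ((a + s) ^ (α * β) / (α * β)) := by
    rw [lintegral_sub_left_eq_self (φ (a + s)) a, hφ]
    simp only
    rw [lintegral_indicator measurableSet_Ioo, lintegral_Ioo_rpow (by positivity) (by positivity)]
  have i2 : ∫⁻ w, φ s (-w) = ENNReal.ofReal (s ^ (α * β) / (α * β)) := by
    rw [lintegral_neg_eq_self (φ s), hφ]
    simp only
    rw [lintegral_indicator measurableSet_Ioo, lintegral_Ioo_rpow (by positivity) (by positivity)]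
  have hγ' : 0 < α * (1 - γ) := mul_pos hα (by linarith)
  have i3 : ∫⁻ w, ψ (-w) = ENNReal.ofReal (s ^ (-(α * (1 - γ))) / (α * (1 - γ))) := by
    rw [lintegral_neg_eq_self ψ, hψ, lintegral_indicator measurableSet_Ioi,
      lintegral_Ioi_rpow hs hγ']
  have m1 : Measurable fun w => φ (a + s) (a - w) := (hφm _).comp (by fun_prop)
  have m2 : Measurable fun w => φ s (-w) := (hφm _).comp (by fun_prop)
  have m3 : Measurable fun w => ψ (-w) := hψm.comp (by fun_prop)
  rw [lintegral_const_mul _ (by fun_prop), lintegral_add_left (by fun_prop),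
    lintegral_const_mul _ (by fun_prop), lintegral_const_mul _ (by fun_prop),
    lintegral_add_left m1, i1, i2, i3, ← ENNReal.ofReal_add (by positivity) (by positivity),
    ← ENNReal.ofReal_mul (by positivity), ← ENNReal.ofReal_mul (by positivity),
    ← ENNReal.ofReal_add (by positivity) (by positivity), ← ENNReal.ofReal_mul hAα]

lemma abs_rpow_sub_rpow_le {x : ℝ} (hx : 0 < x) (a b : ℝ) :
    |x ^ a - x ^ b| ≤ |a - b| * (|Real.log x| * (x ^ a + x ^ b)) := by
  have key : ∀ y z : ℝ, Real.exp y - Real.exp z ≤ |y - z| * (Real.exp y + Real.exp z) := by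
    intro y z
    have h1 := Real.add_one_le_exp (z - y)
    have h2 : Real.exp z = Real.exp y * Real.exp (z - y) := by rw [← Real.exp_add]; ring_nf
    have h3 := le_abs_self (y - z)
    have h4 := Real.exp_pos y
    have h5 := Real.exp_pos z
    have h6 := abs_nonneg (y - z)
    calc Real.exp y - Real.exp z = Real.exp y * (1 - Real.exp (z - y)) := by rw [h2]; ring
      _ ≤ Real.exp y * |y - z| := by gcongr; linarith
      _ ≤ |y - z| * (Real.exp y + Real.exp z) := by nlinarith [mul_nonneg h6 h5.le]
  have hlog : |Real.log x * a - Real.log x * b| = |a - b| * |Real.log x| := by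
    rw [← mul_sub, abs_mul, mul_comm]
  rw [Real.rpow_def_of_pos hx, Real.rpow_def_of_pos hx, ← mul_assoc, ← hlog, abs_le]
  constructor
  · have := key (Real.log x * b) (Real.log x * a)
    rw [abs_sub_comm] at this
    linarith
  · exact key _ _

lemma abs_rpow_add_sub_rpow_le {κ a x : ℝ} (hκ : κ ≤ 1) (ha : 0 < a) (hx : 0 < x) :
    |(x + a) ^ κ - x ^ κ| ≤ |κ| * (a * x ^ (κ - 1)) := by
  have := (convex_Ici x).norm_image_sub_le_of_norm_hasDerivWithin_le
    (f := fun y : ℝ => y ^ κ) (f' := fun y => κ * y ^ (κ - 1)) (C := |κ| * x ^ (κ - 1))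
    (x := x) (y := x + a) (fun y hy => ?_) (fun y hy => ?_) Set.self_mem_Ici
    (by simp [ha.le])
  · simp only [Real.norm_eq_abs, add_sub_cancel_left, abs_of_pos ha] at this
    linarith
  · exact (Real.hasDerivAt_rpow_const (Or.inl (hx.trans_le hy).ne')).hasDerivWithinAt
  · rw [Real.norm_eq_abs, abs_mul, abs_of_nonneg (Real.rpow_nonneg (hx.trans_le hy).le _)]
    exact mul_le_mul_of_nonneg_left
      (Real.rpow_le_rpow_of_nonpos hx hy (by linarith)) (abs_nonneg _)

lemma abs_log_le_mul_rpow_neg {x R δ : ℝ} (hδ : 0 < δ) (hδ1 : δ ≤ 1) (hx : 0 < x) (hxR : x ≤ R)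
    (hR : 1 ≤ R) : |Real.log x| ≤ (1 / δ + R ^ 2) * x ^ (-δ) := by
  have hp := Real.rpow_pos_of_pos hx (-δ)
  rcases le_total x 1 with h1 | h1
  · have h2 := Real.log_le_rpow_div (inv_pos.2 hx).le hδ
    rw [Real.log_inv, Real.inv_rpow hx.le, ← Real.rpow_neg hx.le] at h2
    rw [abs_of_nonpos (Real.log_nonpos hx.le h1)]
    have : 0 ≤ R ^ 2 * x ^ (-δ) := by positivity
    calc _ ≤ x ^ (-δ) / δ := h2
      _ ≤ _ := by rw [add_mul, one_div_mul_eq_div]; linarith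
  · rw [abs_of_nonneg (Real.log_nonneg h1)]
    have h2 : Real.log x ≤ R := (Real.log_le_self hx.le).trans hxR
    have h3 : x ^ δ ≤ R := (Real.rpow_le_self_of_one_le h1 hδ1).trans hxR
    have h4 : 1 ≤ R * x ^ (-δ) := by
      rw [Real.rpow_neg hx.le, ← div_eq_mul_inv, one_le_div (Real.rpow_pos_of_pos hx _)]
      exact h3
    have : 0 ≤ 1 / δ * x ^ (-δ) := by positivity
    calc Real.log x ≤ R * 1 := by linarith
      _ ≤ R * (R * x ^ (-δ)) := by gcongr
      _ ≤ _ := by rw [add_mul]; nlinarith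

lemma rpow_le_mul_rpow {x R p q : ℝ} (hx : 0 < x) (hxR : x ≤ R) (hR : 1 ≤ R) (hpq : p ≤ q)
    (hq : q ≤ p + 1) : x ^ q ≤ R * x ^ p := by
  have h1 : x ^ q = x ^ (q - p) * x ^ p := by rw [← Real.rpow_add hx]; ring_nf
  rw [h1]
  gcongr
  rcases le_total x 1 with h | h
  · exact (Real.rpow_le_one hx.le h (by linarith)).trans hR
  · exact (Real.rpow_le_self_of_one_le h (by linarith)).trans hxR

lemma abs_rpow_sub_rpow_add_sub_le {κ κ' a x B p δ : ℝ} (hκp : κ ≤ p) (hκp' : κ' ≤ p)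
    (hδ : 0 < δ) (hp : p + δ ≤ 1) (hB : |κ'| ≤ B) (ha : 0 < a) (hx : 1 ≤ x) :
    |((x + a) ^ κ - (x + a) ^ κ') - (x ^ κ - x ^ κ')| ≤
      |κ - κ'| * (1 + 2 * B / δ) * (a * x ^ (p + δ - 1)) := by
  have hx0 : 0 < x := by linarith
  have := (convex_Ici x).norm_image_sub_le_of_norm_hasDerivWithin_le
    (f := fun y : ℝ => y ^ κ - y ^ κ') (f' := fun y => κ * y ^ (κ - 1) - κ' * y ^ (κ' - 1))
    (C := |κ - κ'| * (1 + 2 * B / δ) * x ^ (p + δ - 1))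
    (x := x) (y := x + a) (fun y hy => ?_) (fun y hy => ?_) Set.self_mem_Ici
    (by simp [ha.le])
  · simp only [Real.norm_eq_abs, add_sub_cancel_left, abs_of_pos ha] at this
    linarith
  · exact ((Real.hasDerivAt_rpow_const (Or.inl (hx0.trans_le hy).ne')).sub
      (Real.hasDerivAt_rpow_const (Or.inl (hx0.trans_le hy).ne'))).hasDerivWithinAt
  · have hyx : x ≤ y := hy
    have hy1 : 1 ≤ y := hx.trans hy
    have hy0 : 0 < y := by linarith
    have hB0 : 0 ≤ B := (abs_nonneg _).trans hB
    have hmono : y ^ (p + δ - 1) ≤ x ^ (p + δ - 1) :=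
      Real.rpow_le_rpow_of_nonpos hx0 hy (by linarith)
    have e0 : y ^ (κ - 1) ≤ y ^ (p + δ - 1) :=
      Real.rpow_le_rpow_of_exponent_le hy1 (by linarith)
    have e1 : |Real.log y| * (y ^ (κ - 1) + y ^ (κ' - 1)) ≤ 2 / δ * y ^ (p + δ - 1) := by
      have l1 := Real.log_le_rpow_div hy0.le hδ
      rw [abs_of_nonneg (Real.log_nonneg hy1)]
      have e2 : y ^ (κ - 1) ≤ y ^ (p - 1) := Real.rpow_le_rpow_of_exponent_le hy1 (by linarith)
      have e3 : y ^ (κ' - 1) ≤ y ^ (p - 1) := Real.rpow_le_rpow_of_exponent_le hy1 (by linarith)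
      calc _ ≤ y ^ δ / δ * (y ^ (p - 1) + y ^ (p - 1)) := by gcongr
        _ = 2 / δ * (y ^ δ * y ^ (p - 1)) := by ring
        _ = _ := by rw [← Real.rpow_add hy0]; ring_nf
    calc ‖κ * y ^ (κ - 1) - κ' * y ^ (κ' - 1)‖
        = |(κ - κ') * y ^ (κ - 1) + κ' * (y ^ (κ - 1) - y ^ (κ' - 1))| := by
          rw [Real.norm_eq_abs]; ring_nf
      _ ≤ |κ - κ'| * y ^ (κ - 1) + |κ'| * |y ^ (κ - 1) - y ^ (κ' - 1)| := by
          refine (abs_add_le _ _).trans ?_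
          rw [abs_mul, abs_mul, abs_of_nonneg (Real.rpow_nonneg hy0.le (κ - 1))]
      _ ≤ |κ - κ'| * y ^ (p + δ - 1) + B * (|κ - κ'| * (2 / δ * y ^ (p + δ - 1))) := by
          gcongr
          have := abs_rpow_sub_rpow_le hy0 (κ - 1) (κ' - 1)
          rw [show κ - 1 - (κ' - 1) = κ - κ' by ring] at this
          exact this.trans (by gcongr)
      _ = |κ - κ'| * (1 + 2 * B / δ) * y ^ (p + δ - 1) := by ring
      _ ≤ _ := by gcongr

lemma lintegral_fin_prod_eq_prod {n : ℕ} {f : Fin n → ℝ → ℝ≥0∞} (hf : ∀ i, Measurable (f i)) :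
    ∫⁻ w : Fin n → ℝ, ∏ i, f i (w i) = ∏ i, ∫⁻ x, f i x := by
  induction n with
  | zero => simp [volume_pi]
  | succ n ih =>
    rw [← ((volume_preserving_piFinSuccAbove (fun _ : Fin (n + 1) => ℝ) 0).symm).lintegral_comp_emb
      (MeasurableEquiv.measurableEmbedding _)]
    simp only [MeasurableEquiv.piFinSuccAbove_symm_apply, Fin.insertNthEquiv,
      Fin.prod_univ_succ, Fin.insertNth_zero, Equiv.coe_fn_mk, Fin.cons_succ, Fin.cons_zero]
    rw [← ih (f := fun (i : Fin n) => f i.succ) fun i => hf i.succ, Measure.volume_eq_prod]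
    exact lintegral_prod_mul (g := fun x : Fin n → ℝ => ∏ i : Fin n, f i.succ (x i)) (hf 0).aemeasurable
      (Finset.measurable_prod _ fun (i : Fin n) _ => (hf i.succ).comp (measurable_pi_apply i)).aemeasurable

lemma ppow_of_pos {x : ℝ} (hx : 0 < x) (c : ℝ) : ppow x c = x ^ c := if_pos hx

lemma ppow_of_nonpos {x : ℝ} (hx : x ≤ 0) (c : ℝ) : ppow x c = 0 := if_neg hx.not_gt

lemma abs_sub_inv_le {α h : ℝ} (hα : 0 < α) (h0 : 0 ≤ h) (h1 : h ≤ 1) :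
    |h - 1 / α| ≤ 1 + 1 / α := by
  have : 0 < 1 / α := by positivity
  rw [abs_le]; constructor <;> linarith

lemma exists_lintegral_ppow_sub_le {α m M : ℝ} (hα : 0 < α) (hm : 0 < m) (hM : M < 1) :
    ∃ C : ℝ, 0 ≤ C ∧ ∀ h, m ≤ h → h ≤ M → ∀ a b : ℝ,
      ∫⁻ w, ENNReal.ofReal (|ppow (a - w) (h - 1 / α) - ppow (b - w) (h - 1 / α)| ^ α) ≤
        ENNReal.ofReal (C * |a - b| ^ (α * h)) := by
  have hM' : 0 < 1 - M := by linarith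
  have hα' : 0 < 1 / α := by positivity
  set A := 1 + 1 / α with hA
  have hA0 : 0 < A := by positivity
  refine ⟨A ^ α * (2 ^ α * (2 ^ α / (α * m) + 1 / (α * m)) + 1 / (α * (1 - M))),
    by positivity, fun h hmh hhM => ?_⟩
  have hh : 0 < h := hm.trans_le hmh
  suffices H : ∀ a b : ℝ, b < a →
      ∫⁻ w, ENNReal.ofReal (|ppow (a - w) (h - 1 / α) - ppow (b - w) (h - 1 / α)| ^ α) ≤
        ENNReal.ofReal (A ^ α * (2 ^ α * (2 ^ α / (α * m) + 1 / (α * m)) + 1 / (α * (1 - M))) *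
          |a - b| ^ (α * h)) by
    intro a b
    rcases lt_trichotomy a b with hab | hab | hab
    · have := H b a hab
      rw [abs_sub_comm b a] at this
      refine le_trans (le_of_eq ?_) this
      simp_rw [abs_sub_comm]
    · subst hab
      simp [Real.zero_rpow hα.ne']
    · exact H a b hab
  intro a b hab
  set δ := a - b with hδ
  have hδ0 : 0 < δ := sub_pos.2 hab
  rw [abs_of_pos hδ0]
  have key := lintegral_increment_le (α := α) (β := h) (γ := h) (a := δ) (s := δ) (A := A)
    (q := fun x => ppow x (h - 1 / α)) hα hh (by linarith) hδ0 hδ0 hA0.le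
    (fun x hx => ppow_of_nonpos hx _) (fun x hx _ => ?_) (fun x hx => ?_)
  · rw [← lintegral_add_right_eq_self _ b]
    have e : ∀ w : ℝ, a - (w + b) = δ - w ∧ b - (w + b) = -w := fun w => by
      constructor <;> ring
    simp_rw [fun w => (e w).1, fun w => (e w).2]
    refine key.trans (ENNReal.ofReal_le_ofReal ?_)
    rw [mul_assoc]
    gcongr
    have t1 : (δ + δ) ^ (α * h) ≤ 2 ^ α * δ ^ (α * h) := by
      rw [← two_mul, Real.mul_rpow (by norm_num) hδ0.le]
      gcongr
      · norm_num
      · nlinarith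
    have t2 : δ ^ α * δ ^ (-(α * (1 - h))) = δ ^ (α * h) := by
      rw [← Real.rpow_add hδ0]; ring_nf
    have hp := Real.rpow_pos_of_pos hδ0 (α * h)
    calc _ = 2 ^ α * ((δ + δ) ^ (α * h) / (α * h) + δ ^ (α * h) / (α * h)) +
          (δ ^ α * δ ^ (-(α * (1 - h)))) / (α * (1 - h)) := by ring
      _ ≤ 2 ^ α * (2 ^ α * δ ^ (α * h) / (α * m) + δ ^ (α * h) / (α * m)) +
          δ ^ (α * h) / (α * (1 - M)) := by
        rw [t2]
        gcongr
      _ = _ := by ring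
  · rw [ppow_of_pos hx, abs_of_nonneg (Real.rpow_nonneg hx.le _)]
    have := Real.rpow_nonneg hx.le (h - 1 / α)
    rw [hA]
    nlinarith
  · have hx0 : 0 < x := hδ0.trans_le hx
    rw [ppow_of_pos (by linarith), ppow_of_pos hx0]
    refine (abs_rpow_add_sub_rpow_le (by linarith) hδ0 hx0).trans ?_
    have := abs_sub_inv_le hα hh.le (by linarith)
    gcongr

lemma exists_lintegral_ppow_hurst_sub_le {α m M T : ℝ} (hα : 0 < α) (hm : 0 < m)
    (hM : M < 1) (hT : 0 < T) :
    ∃ C : ℝ, 0 ≤ C ∧ ∀ h h', m ≤ h → h ≤ M → m ≤ h' → h' ≤ M → ∀ a : ℝ, 0 < a → a ≤ T →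
      ∫⁻ w, ENNReal.ofReal (|(ppow (a - w) (h - 1 / α) - ppow (-w) (h - 1 / α)) -
          (ppow (a - w) (h' - 1 / α) - ppow (-w) (h' - 1 / α))| ^ α) ≤
        ENNReal.ofReal (C * |h - h'| ^ α) := by
  have hM' : 0 < 1 - M := by linarith
  have hα' : 0 < 1 / α := by positivity
  set R := T + 1 with hR
  have hR1 : 1 ≤ R := by linarith
  set δ := (1 - M) / 2 with hδ
  have hδ0 : 0 < δ := by positivity
  set B := 1 + 1 / α with hB
  set A := (1 / (m / 2) + R ^ 2) * (2 * R) + (1 + 2 * B / δ) with hA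
  have hA1 : 0 ≤ (1 / (m / 2) + R ^ 2) * (2 * R) := by positivity
  have hA2 : 0 ≤ 1 + 2 * B / δ := by positivity
  have hA0 : 0 ≤ A := by positivity
  refine ⟨A ^ α * (2 ^ α * (R ^ (α * (m / 2)) / (α * (m / 2)) + 1 / (α * (m / 2))) +
    T ^ α * (1 / (α * (1 - (M + δ))))), ?_, ?_⟩
  · have : 0 < 1 - (M + δ) := by rw [hδ]; linarith
    positivity
  intro h h' hmh hhM hmh' hhM' a ha haT
  have hγ : 0 < 1 - (M + δ) := by rw [hδ]; linarith
  have key := lintegral_increment_le (α := α) (β := m / 2) (γ := M + δ) (a := a) (s := 1)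
    (A := |h - h'| * A) (q := fun x => ppow x (h - 1 / α) - ppow x (h' - 1 / α)) hα
    (by positivity) (by linarith) ha one_pos (by positivity)
    (fun x hx => by simp [ppow_of_nonpos hx]) (fun x hx hxa => ?_) (fun x hx => ?_)
  · refine le_trans (le_of_eq ?_) (key.trans (ENNReal.ofReal_le_ofReal ?_))
    · refine lintegral_congr fun w => ?_
      congr 3
      ring
    · rw [Real.mul_rpow (abs_nonneg _) hA0, Real.one_rpow, Real.one_rpow,
        mul_comm (|h - h'| ^ α), mul_assoc, mul_assoc, mul_comm (|h - h'| ^ α)]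
      have : a + 1 ≤ R := by linarith
      gcongr
  · have e := abs_rpow_sub_rpow_le hx (h - 1 / α) (h' - 1 / α)
    rw [ppow_of_pos hx, ppow_of_pos hx]
    refine e.trans ?_
    rw [show h - 1 / α - (h' - 1 / α) = h - h' by ring, mul_assoc]
    refine mul_le_mul_of_nonneg_left ?_ (abs_nonneg _)
    have hxR : x ≤ R := by linarith
    calc _ ≤ ((1 / (m / 2) + R ^ 2) * x ^ (-(m / 2))) *
          (R * x ^ (m - 1 / α) + R * x ^ (m - 1 / α)) := by
          gcongr
          · exact abs_log_le_mul_rpow_neg (by positivity) (by linarith) hx hxR hR1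
          · exact rpow_le_mul_rpow hx hxR hR1 (by linarith) (by linarith)
          · exact rpow_le_mul_rpow hx hxR hR1 (by linarith) (by linarith)
      _ = (1 / (m / 2) + R ^ 2) * (2 * R) * (x ^ (-(m / 2)) * x ^ (m - 1 / α)) := by ring
      _ = (1 / (m / 2) + R ^ 2) * (2 * R) * x ^ (m / 2 - 1 / α) := by
          rw [← Real.rpow_add hx]; ring_nf
      _ ≤ A * x ^ (m / 2 - 1 / α) := by gcongr; linarith
  · have hx0 : 0 < x := by linarith
    have := abs_rpow_sub_rpow_add_sub_le (κ := h - 1 / α) (κ' := h' - 1 / α) (a := a) (x := x)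
      (B := B) (p := M - 1 / α) (δ := δ) (by linarith) (by linarith) hδ0
      (by rw [hδ]; linarith) (abs_sub_inv_le hα (by linarith) (by linarith)) ha hx
    rw [ppow_of_pos (by linarith), ppow_of_pos (by linarith), ppow_of_pos hx0, ppow_of_pos hx0]
    refine this.trans ?_
    rw [show h - 1 / α - (h' - 1 / α) = h - h' by ring,
      show M - 1 / α + δ - 1 = M + δ - 1 / α - 1 by ring]
    gcongr
    linarith

lemma abs_prod_sub_prod_le {ι : Type*} [DecidableEq ι] (s : Finset ι) (a b : ι → ℝ) :
    |∏ i ∈ s, a i - ∏ i ∈ s, b i| ≤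
      ∑ l ∈ s, ∏ j ∈ s, if j = l then |a j - b j| else |a j| + |b j| := by
  induction s using Finset.induction_on with
  | empty => simp
  | insert i s hi ih =>
    rw [Finset.prod_insert hi, Finset.prod_insert hi, Finset.sum_insert hi]
    have e1 : a i * ∏ j ∈ s, a j - b i * ∏ j ∈ s, b j =
        (a i - b i) * ∏ j ∈ s, b j + a i * (∏ j ∈ s, a j - ∏ j ∈ s, b j) := by ring
    rw [e1]
    refine (abs_add_le _ _).trans (add_le_add ?_ ?_)
    · rw [Finset.prod_insert hi, if_pos rfl, abs_mul, Finset.abs_prod]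
      gcongr with j hj
      rw [if_neg (ne_of_mem_of_not_mem hj hi)]
      linarith [abs_nonneg (a j)]
    · rw [abs_mul]
      refine (mul_le_mul_of_nonneg_left ih (abs_nonneg _)).trans ?_
      rw [Finset.mul_sum]
      refine Finset.sum_le_sum fun l hl => ?_
      rw [Finset.prod_insert hi, if_neg (ne_of_mem_of_not_mem hl hi).symm]
      refine mul_le_mul_of_nonneg_right (by linarith [abs_nonneg (b i)])
        (Finset.prod_nonneg fun j _ => ?_)
      split_ifs <;> positivity

lemma sum_rpow_le_card_rpow_mul_sum {ι : Type*} (s : Finset ι) {x : ι → ℝ} {α : ℝ} (hα : 0 < α)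
    (hx : ∀ i ∈ s, 0 ≤ x i) : (∑ i ∈ s, x i) ^ α ≤ (#s : ℝ) ^ α * ∑ i ∈ s, x i ^ α := by
  rcases s.eq_empty_or_nonempty with rfl | hs
  · simp [Real.zero_rpow hα.ne']
  obtain ⟨k, hk, hmax⟩ := s.exists_max_image x hs
  have h1 : ∑ i ∈ s, x i ≤ #s * x k := by
    simpa using Finset.sum_le_card_nsmul s x (x k) hmax
  calc (∑ i ∈ s, x i) ^ α ≤ (#s * x k) ^ α :=
        Real.rpow_le_rpow (Finset.sum_nonneg hx) h1 hα.le
    _ = (#s : ℝ) ^ α * x k ^ α := Real.mul_rpow (by positivity) (hx k hk)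
    _ ≤ _ := by
      gcongr
      exact Finset.single_le_sum (f := fun i => x i ^ α)
        (fun i hi => Real.rpow_nonneg (hx i hi) _) hk

lemma lintegral_abs_prod_sub_prod_rpow_le {N : ℕ} {α D K : ℝ} (hα : 0 < α) (hD : 0 ≤ D)
    (hK : 1 ≤ K) {F G : Fin N → ℝ → ℝ} (hFm : ∀ i, Measurable (F i))
    (hGm : ∀ i, Measurable (G i))
    (hF : ∀ i, ∫⁻ x, ENNReal.ofReal (|F i x| ^ α) ≤ ENNReal.ofReal K)
    (hG : ∀ i, ∫⁻ x, ENNReal.ofReal (|G i x| ^ α) ≤ ENNReal.ofReal K)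
    (hFG : ∀ i, ∫⁻ x, ENNReal.ofReal (|F i x - G i x| ^ α) ≤ ENNReal.ofReal D) :
    ∫⁻ w : Fin N → ℝ, ENNReal.ofReal (|∏ i, F i (w i) - ∏ i, G i (w i)| ^ α) ≤
      ENNReal.ofReal ((N : ℝ) ^ α * (N * (D * (2 ^ α * (K + K)) ^ (N - 1)))) := by
  classical
  set f : Fin N → Fin N → ℝ → ℝ≥0∞ := fun l j x =>
    if j = l then ENNReal.ofReal (|F j x - G j x| ^ α)
    else ENNReal.ofReal (2 ^ α) * (ENNReal.ofReal (|F j x| ^ α) + ENNReal.ofReal (|G j x| ^ α))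
    with hf
  have hfm : ∀ l j, Measurable (f l j) := by
    intro l j
    have := hFm j
    have := hGm j
    simp only [hf]
    split_ifs <;> fun_prop
  have hpt : ∀ w : Fin N → ℝ, ENNReal.ofReal (|∏ i, F i (w i) - ∏ i, G i (w i)| ^ α) ≤
      ENNReal.ofReal ((N : ℝ) ^ α) * ∑ l, ∏ j, f l j (w j) := by
    intro w
    set P : Fin N → Fin N → ℝ := fun l j =>
      if j = l then |F j (w j) - G j (w j)| else |F j (w j)| + |G j (w j)| with hP
    have hP0 : ∀ l j, 0 ≤ P l j := by
      intro l j
      simp only [hP]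
      split_ifs <;> positivity
    have h1 : |∏ i, F i (w i) - ∏ i, G i (w i)| ^ α ≤
        (N : ℝ) ^ α * ∑ l, ∏ j, P l j ^ α := by
      calc _ ≤ (∑ l, ∏ j, P l j) ^ α :=
            Real.rpow_le_rpow (abs_nonneg _)
              (abs_prod_sub_prod_le univ (fun i => F i (w i)) fun i => G i (w i)) hα.le
        _ ≤ (N : ℝ) ^ α * ∑ l, (∏ j, P l j) ^ α := by
            have := sum_rpow_le_card_rpow_mul_sum univ (x := fun l => ∏ j, P l j) hα
              (fun l _ => Finset.prod_nonneg fun j _ => hP0 l j)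
            simpa using this
        _ = _ := by
            congr 1
            exact Finset.sum_congr rfl fun l _ =>
              (Real.finsetProd_rpow _ _ (fun j _ => hP0 l j) _).symm
    refine (ENNReal.ofReal_le_ofReal h1).trans ?_
    rw [ENNReal.ofReal_mul (by positivity), ENNReal.ofReal_sum_of_nonneg
      (fun l _ => Finset.prod_nonneg fun j _ => Real.rpow_nonneg (hP0 l j) _)]
    gcongr with l _
    rw [ENNReal.ofReal_prod_of_nonneg fun j _ => Real.rpow_nonneg (hP0 l j) _]
    gcongr with j _
    simp only [hP, hf]
    split_ifs with hjl
    · exact le_rfl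
    · rw [← ENNReal.ofReal_add (by positivity) (by positivity), ← ENNReal.ofReal_mul (by positivity)]
      apply ENNReal.ofReal_le_ofReal
      have := abs_add_rpow_le hα |F j (w j)| |G j (w j)|
      rwa [abs_abs, abs_abs, abs_of_nonneg (add_nonneg (abs_nonneg _) (abs_nonneg _))] at this
  have hK' : 0 ≤ 2 ^ α * (K + K) := by positivity
  have hint : ∀ l j, ∫⁻ x, f l j x ≤
      if j = l then ENNReal.ofReal D else ENNReal.ofReal (2 ^ α * (K + K)) := by
    intro l j
    simp only [hf]
    split_ifs with hjl
    · exact hFG j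
    · have := hFm j
      rw [lintegral_const_mul' _ _ ENNReal.ofReal_ne_top, lintegral_add_left (by fun_prop),
        ENNReal.ofReal_mul (by positivity), ENNReal.ofReal_add (by positivity) (by positivity)]
      gcongr
      · exact hF j
      · exact hG j
  calc _ ≤ ∫⁻ w : Fin N → ℝ, ENNReal.ofReal ((N : ℝ) ^ α) * ∑ l, ∏ j, f l j (w j) :=
        lintegral_mono hpt
    _ = ENNReal.ofReal ((N : ℝ) ^ α) * ∑ l, ∏ j, ∫⁻ x, f l j x := by
        rw [lintegral_const_mul' _ _ ENNReal.ofReal_ne_top, lintegral_finsetSum]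
        · simp_rw [lintegral_fin_prod_eq_prod (hfm _)]
        · exact fun l _ => Finset.measurable_prod _ fun j _ =>
            (hfm l j).comp (measurable_pi_apply j)
    _ ≤ ENNReal.ofReal ((N : ℝ) ^ α) *
        ∑ l : Fin N, ENNReal.ofReal D * ENNReal.ofReal (2 ^ α * (K + K)) ^ (N - 1) := by
        gcongr with l _
        refine (Finset.prod_le_prod' fun j _ => hint l j).trans (le_of_eq ?_)
        rw [← Finset.mul_prod_erase univ _ (mem_univ l), if_pos rfl]
        congr 1
        rw [Finset.prod_congr rfl fun j hj => if_neg (Finset.ne_of_mem_erase hj)]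
        simp
    _ = _ := by
        rw [ENNReal.ofReal_mul (by positivity : 0 ≤ (N : ℝ) ^ α),
          ENNReal.ofReal_mul (by positivity : 0 ≤ (N : ℝ)), ENNReal.ofReal_mul hD, ENNReal.ofReal_pow hK']
        simp

lemma measurable_ppow (c : ℝ) : Measurable fun x => ppow x c :=
  Measurable.ite (measurableSet_lt measurable_const measurable_id) (by fun_prop) measurable_const

/-- Upper bound for the `α`-increments of the kernel. -/
lemma exists_lintegral_increment_le {N : ℕ} {α m M T c : ℝ} (hα : 0 < α) (hm : 0 < m)
    (hM : M < 1) (hT : 0 < T) (hc : 0 ≤ c) :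
    ∃ C : ℝ, 0 < C ∧ ∀ η θ u v : Fin N → ℝ, (∀ i, m ≤ η i ∧ η i ≤ M) →
      (∀ i, m ≤ θ i ∧ θ i ≤ M) → (∀ i, 0 < u i ∧ u i ≤ T) → (∀ i, 0 < v i ∧ v i ≤ T) →
      ∀ r : ℝ, 0 ≤ r → (∀ i, |u i - v i| ^ θ i ≤ r) → (∀ i, |η i - θ i| ≤ c * r) →
      ∫⁻ w : Fin N → ℝ, ENNReal.ofReal
        (|∏ i, (ppow (u i - w i) (η i - 1 / α) - ppow (-w i) (η i - 1 / α)) -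
          ∏ i, (ppow (v i - w i) (θ i - 1 / α) - ppow (-w i) (θ i - 1 / α))| ^ α) ≤
        ENNReal.ofReal (C * r ^ α) := by
  obtain ⟨C₁, hC₁, H₁⟩ := exists_lintegral_ppow_sub_le hα hm hM
  obtain ⟨C₂, hC₂, H₂⟩ := exists_lintegral_ppow_hurst_sub_le hα hm hM hT
  set K := 1 + C₁ * (T + 1) ^ α with hK
  have hK1 : 1 ≤ K := by
    have : 0 ≤ C₁ * (T + 1) ^ α := by positivity
    linarith
  set E := 2 ^ α * (C₂ * c ^ α + C₁) with hE
  have hE0 : 0 ≤ E := by positivity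
  refine ⟨(N : ℝ) ^ α * (N * (E * (2 ^ α * (K + K)) ^ (N - 1))) + 1, by positivity, ?_⟩
  intro η θ u v hη hθ hu hv r hr huv hηθ
  have single : ∀ η u : ℝ, m ≤ η → η ≤ M → 0 < u → u ≤ T →
      ∫⁻ x, ENNReal.ofReal (|ppow (u - x) (η - 1 / α) - ppow (-x) (η - 1 / α)| ^ α) ≤
        ENNReal.ofReal K := by
    intro η u h1 h2 h3 h4
    have := H₁ η h1 h2 u 0
    simp only [zero_sub, sub_zero, abs_of_pos h3] at this
    refine this.trans (ENNReal.ofReal_le_ofReal ?_)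
    have : u ^ (α * η) ≤ (T + 1) ^ α := by
      calc u ^ (α * η) ≤ (T + 1) ^ (α * η) :=
            Real.rpow_le_rpow h3.le (by linarith) (mul_nonneg hα.le (by linarith))
        _ ≤ (T + 1) ^ α :=
            Real.rpow_le_rpow_of_exponent_le (by linarith) (by nlinarith)
    rw [hK]
    have := mul_le_mul_of_nonneg_left this hC₁
    linarith
  have hr' : 0 ≤ r ^ α := Real.rpow_nonneg hr _
  have hmeas : ∀ a b : ℝ, Measurable fun x => ppow (a - x) b - ppow (-x) b := fun a b =>
    ((measurable_ppow b).comp (by fun_prop)).sub ((measurable_ppow b).comp (by fun_prop))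
  have main := lintegral_abs_prod_sub_prod_rpow_le (α := α) (D := E * r ^ α) (K := K) hα
    (by positivity) hK1
    (F := fun i x => ppow (u i - x) (η i - 1 / α) - ppow (-x) (η i - 1 / α))
    (G := fun i x => ppow (v i - x) (θ i - 1 / α) - ppow (-x) (θ i - 1 / α))
    (fun i => hmeas _ _) (fun i => hmeas _ _)
    (fun i => single _ _ (hη i).1 (hη i).2 (hu i).1 (hu i).2)
    (fun i => single _ _ (hθ i).1 (hθ i).2 (hv i).1 (hv i).2) (fun i => ?_)
  · refine main.trans (ENNReal.ofReal_le_ofReal ?_)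
    rw [add_mul]
    have : (N : ℝ) ^ α * (N * (E * r ^ α * (2 ^ α * (K + K)) ^ (N - 1))) =
      (N : ℝ) ^ α * (N * (E * (2 ^ α * (K + K)) ^ (N - 1))) * r ^ α := by ring
    linarith
  · have h1 := H₂ (η i) (θ i) (hη i).1 (hη i).2 (hθ i).1 (hθ i).2 (u i) (hu i).1 (hu i).2
    have h2 := H₁ (θ i) (hθ i).1 (hθ i).2 (u i) (v i)
    have e1 : |η i - θ i| ^ α ≤ c ^ α * r ^ α := by
      rw [← Real.mul_rpow hc hr]
      exact Real.rpow_le_rpow (abs_nonneg _) (hηθ i) hα.le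
    have e2 : |u i - v i| ^ (α * θ i) ≤ r ^ α := by
      rw [mul_comm, Real.rpow_mul (abs_nonneg _)]
      exact Real.rpow_le_rpow (Real.rpow_nonneg (abs_nonneg _) _) (huv i) hα.le
    have mm := (hmeas (u i) (η i - 1 / α)).sub (hmeas (u i) (θ i - 1 / α))
    calc _ ≤ ∫⁻ x, ENNReal.ofReal (2 ^ α) * (ENNReal.ofReal
            (|(ppow (u i - x) (η i - 1 / α) - ppow (-x) (η i - 1 / α)) -
              (ppow (u i - x) (θ i - 1 / α) - ppow (-x) (θ i - 1 / α))| ^ α) +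
            ENNReal.ofReal (|ppow (u i - x) (θ i - 1 / α) - ppow (v i - x) (θ i - 1 / α)| ^ α)) := by
          refine lintegral_mono fun x => ?_
          rw [← ENNReal.ofReal_add (by positivity) (by positivity),
            ← ENNReal.ofReal_mul (by positivity)]
          apply ENNReal.ofReal_le_ofReal
          refine le_trans (le_of_eq ?_) (abs_add_rpow_le hα _ _)
          congr 2
          ring
      _ = ENNReal.ofReal (2 ^ α) * (_ + _) := by
          rw [lintegral_const_mul' _ _ ENNReal.ofReal_ne_top,
            lintegral_add_left (by simp only [Pi.sub_def] at mm; fun_prop)]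
      _ ≤ ENNReal.ofReal (2 ^ α) * (ENNReal.ofReal (C₂ * (c ^ α * r ^ α)) +
          ENNReal.ofReal (C₁ * r ^ α)) := by
          gcongr
          · exact h1.trans (ENNReal.ofReal_le_ofReal (by gcongr))
          · exact h2.trans (ENNReal.ofReal_le_ofReal (by gcongr))
      _ = _ := by
          rw [← ENNReal.ofReal_add (by positivity) (by positivity),
            ← ENNReal.ofReal_mul (by positivity), hE]
          congr 1
          ring

/-- Lower bound for the `α`-increments of the kernel. -/
lemma le_lintegral_increment {N : ℕ} {α ε : ℝ} (hα : 0 < α) (hα2 : α ≤ 2) (hε : 0 < ε)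
    {η θ u v : Fin N → ℝ} (hη : ∀ i, 0 < η i ∧ η i < 1) (hu : ∀ i, ε ≤ u i)
    {l : Fin N} (hvl : 0 < v l) (hlu : v l < u l) :
    ENNReal.ofReal ((min ε 1 ^ 2 / 2) ^ N * (u l - v l) ^ (α * η l)) ≤
      ∫⁻ w : Fin N → ℝ, ENNReal.ofReal
        (|∏ i, (ppow (u i - w i) (η i - 1 / α) - ppow (-w i) (η i - 1 / α)) -
          ∏ i, (ppow (v i - w i) (θ i - 1 / α) - ppow (-w i) (θ i - 1 / α))| ^ α) := by
  classical
  set δ : Fin N → ℝ := fun j => if j = l then u l - v l else u j with hδ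
  have hδ0 : ∀ j, 0 < δ j := by
    intro j
    simp only [hδ]
    split_ifs
    · linarith
    · exact hε.trans_le (hu j)
  have hδu : ∀ j, δ j ≤ u j := by
    intro j
    simp only [hδ]
    split_ifs with hj
    · subst hj; linarith
    · exact le_rfl
  set f : Fin N → ℝ → ℝ≥0∞ := fun j =>
    (Set.Ioo 0 (δ j)).indicator fun x => ENNReal.ofReal (x ^ (α * η j - 1)) with hf
  have hfm : ∀ j, Measurable (f j) := fun j =>
    Measurable.indicator (by fun_prop) measurableSet_Ioo
  have hpt : ∀ w : Fin N → ℝ, ∏ j, f j (u j - w j) ≤ ENNReal.ofReal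
        (|∏ i, (ppow (u i - w i) (η i - 1 / α) - ppow (-w i) (η i - 1 / α)) -
          ∏ i, (ppow (v i - w i) (θ i - 1 / α) - ppow (-w i) (θ i - 1 / α))| ^ α) := by
    intro w
    by_cases hw : ∀ j, u j - w j ∈ Set.Ioo 0 (δ j)
    · have hw0 : ∀ j, -w j ≤ 0 := fun j => by linarith [(hw j).2, hδu j]
      have hvw : v l - w l ≤ 0 := by
        have := (hw l).2
        simp only [hδ, if_true] at this
        linarith
      have z : ∏ i, (ppow (v i - w i) (θ i - 1 / α) - ppow (-w i) (θ i - 1 / α)) = 0 :=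
        Finset.prod_eq_zero (mem_univ l)
          (by rw [ppow_of_nonpos hvw, ppow_of_nonpos (hw0 l), sub_zero])
      have e : ∏ i, (ppow (u i - w i) (η i - 1 / α) - ppow (-w i) (η i - 1 / α)) =
          ∏ i, (u i - w i) ^ (η i - 1 / α) :=
        Finset.prod_congr rfl fun j _ => by
          rw [ppow_of_pos (hw j).1, ppow_of_nonpos (hw0 j), sub_zero]
      have hnn : ∀ j, 0 ≤ (u j - w j) ^ (η j - 1 / α) := fun j =>
        Real.rpow_nonneg (hw j).1.le _
      rw [z, e, sub_zero, abs_of_nonneg (Finset.prod_nonneg fun j _ => hnn j),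
        ← Real.finsetProd_rpow _ _ (fun j _ => hnn j),
        ENNReal.ofReal_prod_of_nonneg fun j _ => Real.rpow_nonneg (hnn j) _]
      refine Finset.prod_le_prod' fun j _ => ?_
      simp only [hf]
      rw [Set.indicator_of_mem (hw j), ← Real.rpow_mul (hw j).1.le]
      apply le_of_eq
      congr 2
      field_simp
    · push Not at hw
      obtain ⟨j, hj⟩ := hw
      rw [Finset.prod_eq_zero (mem_univ j)]
      · exact zero_le
      · simp only [hf]
        exact Set.indicator_of_notMem hj _
  refine le_trans ?_ (lintegral_mono hpt)
  rw [lintegral_fin_prod_eq_prod (f := fun j x => f j (u j - x))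
    fun j => (hfm j).comp (by fun_prop)]
  have hint : ∀ j, ∫⁻ x, f j (u j - x) = ENNReal.ofReal (δ j ^ (α * η j) / (α * η j)) := by
    intro j
    rw [lintegral_sub_left_eq_self (f j) (u j)]
    simp only [hf]
    rw [lintegral_indicator measurableSet_Ioo,
      lintegral_Ioo_rpow (hδ0 j) (mul_pos hα (hη j).1)]
  simp_rw [hint]
  have he0 : ∀ j, 0 < α * η j := fun j => mul_pos hα (hη j).1
  have he2 : ∀ j, α * η j ≤ 2 := fun j => by nlinarith [(hη j).2, (hη j).1]
  have hnn : ∀ j, 0 ≤ δ j ^ (α * η j) / (α * η j) := fun j =>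
    div_nonneg (Real.rpow_nonneg (hδ0 j).le _) (he0 j).le
  rw [← ENNReal.ofReal_prod_of_nonneg fun j _ => hnn j]
  apply ENNReal.ofReal_le_ofReal
  have hε1 : 0 < min ε 1 := lt_min hε one_pos
  have hc1 : min ε 1 ^ 2 / 2 ≤ 1 / 2 := by
    have : min ε 1 ^ 2 ≤ 1 := pow_le_one₀ hε1.le (min_le_right _ _)
    linarith
  calc (min ε 1 ^ 2 / 2) ^ N * (u l - v l) ^ (α * η l)
      = ∏ j, (min ε 1 ^ 2 / 2) * if j = l then (u l - v l) ^ (α * η l) else 1 := by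
        rw [Finset.prod_mul_distrib, Finset.prod_const, Finset.card_univ, Fintype.card_fin,
          Finset.prod_ite_eq', if_pos (mem_univ l)]
    _ ≤ _ := by
        refine Finset.prod_le_prod (fun j _ => ?_) (fun j _ => ?_)
        · have : 0 ≤ u l - v l := by linarith
          split_ifs <;> positivity
        · rcases eq_or_ne j l with rfl | hj
          · simp only [hδ, if_true]
            have hp : 0 ≤ (u j - v j) ^ (α * η j) := Real.rpow_nonneg (by linarith) _
            calc _ ≤ 1 / 2 * (u j - v j) ^ (α * η j) := by gcongr
              _ = (u j - v j) ^ (α * η j) / 2 := by ring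
              _ ≤ _ := div_le_div_of_nonneg_left hp (he0 j) (he2 j)
          · simp only [hδ, if_neg hj, mul_one]
            have h1 : min ε 1 ^ 2 ≤ u j ^ (α * η j) := by
              calc min ε 1 ^ 2 = min ε 1 ^ (2 : ℝ) := by norm_cast
                _ ≤ min ε 1 ^ (α * η j) :=
                  Real.rpow_le_rpow_of_exponent_ge hε1 (min_le_right _ _) (he2 j)
                _ ≤ _ := Real.rpow_le_rpow hε1.le ((min_le_left _ _).trans (hu j)) (he0 j).le
            exact div_le_div₀ (Real.rpow_nonneg (hδ0 j |>.le.trans (hδu j)) _) h1 (he0 j) (he2 j)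

lemma inv_one_sub_ofReal_two_rpow_neg_le {s S : ℝ} (hs : s ≤ S) :
    (1 - ENNReal.ofReal (2 ^ (-s)))⁻¹ ≤
      ENNReal.ofReal (2 ^ S / Real.log 2) * (ENNReal.ofReal s)⁻¹ := by
  have hl : 0 < Real.log 2 := Real.log_pos one_lt_two
  have hC : 0 < (2 : ℝ) ^ S / Real.log 2 := by positivity
  rcases le_or_gt s 0 with h0 | h0
  · rw [ENNReal.ofReal_of_nonpos h0, ENNReal.inv_zero, ENNReal.mul_top]
    · exact le_top
    · simpa using hC
  have h1 : s ≤ 2 ^ S / Real.log 2 * (1 - 2 ^ (-s)) := by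
    have e1 : 1 + s * Real.log 2 ≤ (2 : ℝ) ^ s := by
      rw [Real.rpow_def_of_pos two_pos]
      linarith [Real.add_one_le_exp (Real.log 2 * s)]
    have e2 : (2 : ℝ) ^ s ≤ 2 ^ S := Real.rpow_le_rpow_of_exponent_le one_le_two hs
    have e3 : (2 : ℝ) ^ s * 2 ^ (-s) = 1 := by
      rw [← Real.rpow_add two_pos, add_neg_cancel, Real.rpow_zero]
    have e4 : (2 : ℝ) ^ (-s) ≤ 1 :=
      Real.rpow_le_one_of_one_le_of_nonpos one_le_two (by linarith)
    rw [div_mul_eq_mul_div, le_div_iff₀ hl]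
    calc s * Real.log 2 ≤ 2 ^ s - 1 := by linarith
      _ = 2 ^ s * (1 - 2 ^ (-s)) := by rw [mul_sub, e3, mul_one]
      _ ≤ _ := by gcongr
  rw [← ENNReal.ofReal_one, ← ENNReal.ofReal_sub _ (by positivity)]
  have h2 : ENNReal.ofReal s ≤
      ENNReal.ofReal (2 ^ S / Real.log 2) * ENNReal.ofReal (1 - 2 ^ (-s)) := by
    rw [← ENNReal.ofReal_mul hC.le]
    exact ENNReal.ofReal_le_ofReal h1
  have hC' : ENNReal.ofReal (2 ^ S / Real.log 2) ≠ 0 := by simpa using hC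
  calc _ = ENNReal.ofReal (2 ^ S / Real.log 2) *
        (ENNReal.ofReal (2 ^ S / Real.log 2) * ENNReal.ofReal (1 - 2 ^ (-s)))⁻¹ := by
        rw [ENNReal.mul_inv (Or.inl hC') (Or.inl ENNReal.ofReal_ne_top), ← mul_assoc,
          ENNReal.mul_inv_cancel hC' ENNReal.ofReal_ne_top, one_mul]
    _ ≤ _ := by gcongr

lemma inv_ofReal_le_inv_one_sub_ofReal_two_rpow_neg (s : ℝ) :
    (ENNReal.ofReal s)⁻¹ ≤ (1 - ENNReal.ofReal (2 ^ (-s)))⁻¹ := by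
  rw [ENNReal.inv_le_inv, ← ENNReal.ofReal_one, ← ENNReal.ofReal_sub _ (by positivity)]
  have h1 : 1 - (2 : ℝ) ^ (-s) ≤ Real.log 2 * s := by
    rw [Real.rpow_def_of_pos two_pos]
    linarith [Real.add_one_le_exp (Real.log 2 * -s)]
  have hl : 0 < Real.log 2 := Real.log_pos one_lt_two
  have hl1 : Real.log 2 ≤ 1 := by linarith [Real.log_two_lt_d9]
  rcases le_or_gt s 0 with h0 | h0
  · rw [ENNReal.ofReal_of_nonpos (by nlinarith)]
    exact zero_le
  · exact ENNReal.ofReal_le_ofReal (by nlinarith)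

lemma tsum_ite_pow_le {B A : ℝ≥0∞} (hB : 2 ≤ B) {P : ℕ → Prop} [DecidablePred P]
    (h : ∀ k, P k → B ^ k ≤ A) : ∑' k, (if P k then B ^ k else 0) ≤ 2 * A := by
  have hgeom : ∀ n, ∑ k ∈ range n, B ^ k ≤ B ^ n := by
    intro n
    induction n with
    | zero => simp
    | succ n ih =>
      rw [Finset.sum_range_succ, pow_succ']
      calc _ ≤ B ^ n + B ^ n := by gcongr
        _ = 2 * B ^ n := (two_mul _).symm
        _ ≤ _ := by gcongr
  refine ENNReal.tsum_le_of_sum_range_le fun n => ?_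
  induction n with
  | zero => simp
  | succ n ih =>
    rw [Finset.sum_range_succ]
    split_ifs with hn
    · calc _ ≤ ∑ k ∈ range n, B ^ k + B ^ n := by
            gcongr
            split_ifs
            · exact le_rfl
            · exact zero_le
        _ ≤ B ^ n + B ^ n := by gcongr; exact hgeom n
        _ = 2 * B ^ n := (two_mul _).symm
        _ ≤ 2 * A := by gcongr; exact h n hn
    · simpa using ih

/-- The anisotropic box of radius `2⁻ᵏ` around `v`, intersected with `[a, b]^N`. -/
def dyadicBox {N : ℕ} (a b : ℝ) (θ v : Fin N → ℝ) (k : ℕ) : Set (Fin N → ℝ) :=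
  {u | (∀ i, a ≤ u i ∧ u i ≤ b) ∧ ∀ i, |u i - v i| ^ θ i ≤ 2⁻¹ ^ k}

section dyadicBox

variable {N : ℕ} {a b : ℝ} {θ v : Fin N → ℝ}

lemma dyadicBox_eq_Icc (hθ : ∀ i, 0 < θ i) (k : ℕ) :
    dyadicBox a b θ v k = Set.Icc (fun i => max a (v i - (2⁻¹ ^ k) ^ (θ i)⁻¹))
      (fun i => min b (v i + (2⁻¹ ^ k) ^ (θ i)⁻¹)) := by
  ext u
  have e : ∀ i, |u i - v i| ^ θ i ≤ 2⁻¹ ^ k ↔ |u i - v i| ≤ ((2⁻¹ : ℝ) ^ k) ^ (θ i)⁻¹ := fun i =>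
    (Real.le_rpow_inv_iff_of_pos (abs_nonneg _) (by positivity) (hθ i)).symm
  simp only [dyadicBox, Set.mem_ofPred_eq, Set.mem_Icc, Pi.le_def, max_le_iff, le_min_iff, e,
    abs_le, neg_le_sub_iff_le_add, sub_le_iff_le_add, ← forall_and]
  refine forall_congr' fun i => ?_
  constructor
  · rintro ⟨⟨h1, h2⟩, h3, h4⟩
    refine ⟨⟨h1, ?_⟩, h2, ?_⟩ <;> linarith
  · rintro ⟨⟨h1, h3⟩, h2, h4⟩
    refine ⟨⟨h1, h2⟩, ?_, ?_⟩ <;> linarith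

lemma measurableSet_dyadicBox (hθ : ∀ i, 0 < θ i) (k : ℕ) :
    MeasurableSet (dyadicBox a b θ v k) := by
  rw [dyadicBox_eq_Icc hθ]
  exact measurableSet_Icc

lemma prod_inv_two_pow_rpow_inv (θ : Fin N → ℝ) (k : ℕ) :
    ∏ i, ((2⁻¹ : ℝ) ^ k) ^ (θ i)⁻¹ = (2 ^ (-∑ i, 1 / θ i)) ^ k := by
  rw [← Real.rpow_sum_of_pos (by positivity), ← Real.rpow_natCast, ← Real.rpow_natCast,
    ← Real.rpow_mul (by positivity), ← Real.rpow_mul (by positivity), Real.inv_rpow two_pos.le,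
    ← Real.rpow_neg two_pos.le]
  simp only [one_div]
  congr 1
  ring

lemma volume_dyadicBox_le (hθ : ∀ i, 0 < θ i) (k : ℕ) :
    volume (dyadicBox a b θ v k) ≤
      ENNReal.ofReal (2 ^ N) * ENNReal.ofReal (2 ^ (-∑ i, 1 / θ i)) ^ k := by
  rw [dyadicBox_eq_Icc hθ, Real.volume_Icc_pi, ← ENNReal.ofReal_pow (by positivity),
    ← prod_inv_two_pow_rpow_inv, ← ENNReal.ofReal_mul (by positivity)]
  calc _ ≤ ∏ i : Fin N, ENNReal.ofReal (2 * ((2⁻¹ : ℝ) ^ k) ^ (θ i)⁻¹) := by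
        refine Finset.prod_le_prod' fun i _ => ENNReal.ofReal_le_ofReal ?_
        linarith [min_le_right b (v i + (2⁻¹ ^ k) ^ (θ i)⁻¹),
          le_max_right a (v i - (2⁻¹ ^ k) ^ (θ i)⁻¹)]
    _ = _ := by
        rw [← ENNReal.ofReal_prod_of_nonneg fun i _ => by positivity, Finset.prod_mul_distrib]
        simp

lemma le_volume_dyadicBox (hθ : ∀ i, 0 < θ i) (hab : a < b) (hab1 : b - a ≤ 1)
    (hv : ∀ i, a ≤ v i ∧ v i ≤ b) (k : ℕ) :
    ENNReal.ofReal ((b - a) ^ N) * ENNReal.ofReal (2 ^ (-∑ i, 1 / θ i)) ^ k ≤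
      volume (dyadicBox a b θ v k) := by
  have hba : 0 ≤ b - a := by linarith
  rw [dyadicBox_eq_Icc hθ, Real.volume_Icc_pi, ← ENNReal.ofReal_pow (by positivity),
    ← prod_inv_two_pow_rpow_inv, ← ENNReal.ofReal_mul (by positivity)]
  calc _ = ∏ i : Fin N, ENNReal.ofReal ((b - a) * ((2⁻¹ : ℝ) ^ k) ^ (θ i)⁻¹) := by
        rw [← ENNReal.ofReal_prod_of_nonneg fun i _ => by positivity, Finset.prod_mul_distrib]
        simp
    _ ≤ _ := by
        refine Finset.prod_le_prod' fun i _ => ENNReal.ofReal_le_ofReal ?_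
        have h0 : 0 ≤ ((2⁻¹ : ℝ) ^ k) ^ (θ i)⁻¹ := by positivity
        have h1 : ((2⁻¹ : ℝ) ^ k) ^ (θ i)⁻¹ ≤ 1 :=
          Real.rpow_le_one (by positivity) (pow_le_one₀ (by norm_num) (by norm_num))
            (inv_nonneg.2 (hθ i).le)
        have h2 := hv i
        generalize ((2⁻¹ : ℝ) ^ k) ^ (θ i)⁻¹ = ρ at h0 h1 ⊢
        rcases max_choice a (v i - ρ) with e | e <;> rcases min_choice b (v i + ρ) with e' | e' <;>
          rw [e, e'] <;> nlinarith

lemma lintegral_tsum_dyadicBox (hθ : ∀ i, 0 < θ i) (d : ℕ) :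
    ∫⁻ u in Set.Icc (fun _ : Fin N => a) (fun _ => b),
      ∑' k, (dyadicBox a b θ v k).indicator (fun _ => ((2 : ℝ≥0∞) ^ d) ^ k) u =
      ∑' k, ((2 : ℝ≥0∞) ^ d) ^ k * volume (dyadicBox a b θ v k) := by
  rw [lintegral_tsum fun k =>
    (measurable_const.indicator (measurableSet_dyadicBox hθ k)).aemeasurable]
  refine tsum_congr fun k => ?_
  rw [lintegral_indicator_const (measurableSet_dyadicBox hθ k),
    Measure.restrict_apply (measurableSet_dyadicBox hθ k), Set.inter_eq_left.2]
  exact fun u hu => ⟨fun i => (hu.1 i).1, fun i => (hu.1 i).2⟩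

lemma tsum_two_pow_mul_two_rpow (d : ℕ) (Q : ℝ) :
    ∑' k : ℕ, ((2 : ℝ≥0∞) ^ d) ^ k * ENNReal.ofReal (2 ^ (-Q)) ^ k =
      (1 - ENNReal.ofReal (2 ^ (-(Q - d))))⁻¹ := by
  rw [← ENNReal.tsum_geometric]
  refine tsum_congr fun k => ?_
  rw [← mul_pow]
  congr 1
  have : (2 : ℝ≥0∞) ^ d = ENNReal.ofReal (2 ^ (d : ℝ)) := by
    rw [Real.rpow_natCast, ENNReal.ofReal_pow two_pos.le]
    simp
  rw [this, ← ENNReal.ofReal_mul (by positivity), ← Real.rpow_add two_pos]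
  ring_nf

/-- Upper bound for a negative-moment integral of a function dominating an anisotropic distance. -/
lemma lintegral_rpow_neg_le {Ψ : (Fin N → ℝ) → ℝ≥0∞} {d : ℕ} {c S : ℝ} (hc : 0 < c)
    (hθ : ∀ i, 0 < θ i) (hS : ∑ i, 1 / θ i - d ≤ S) (hab1 : b - a ≤ 1)
    (hv : ∀ i, a ≤ v i ∧ v i ≤ b)
    (hΨ : ∀ u, (∀ i, a ≤ u i ∧ u i ≤ b) → ∀ i, ENNReal.ofReal (c * |u i - v i| ^ θ i) ≤ Ψ u) :
    ∫⁻ u in Set.Icc (fun _ : Fin N => a) (fun _ => b), Ψ u ^ (-(d : ℝ)) ≤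
      ENNReal.ofReal (c⁻¹ ^ d * 2 ^ d) * (ENNReal.ofReal (2 ^ N) *
        (ENNReal.ofReal (2 ^ S / Real.log 2) * (ENNReal.ofReal (∑ i, 1 / θ i - d))⁻¹)) := by
  classical
  have hpt : ∀ u ∈ Set.Icc (fun _ : Fin N => a) (fun _ => b), Ψ u ^ (-(d : ℝ)) ≤
      ENNReal.ofReal (c⁻¹ ^ d * 2 ^ d) *
        ∑' k, (dyadicBox a b θ v k).indicator (fun _ => ((2 : ℝ≥0∞) ^ d) ^ k) u := by
    intro u hu
    have huI : ∀ i, a ≤ u i ∧ u i ≤ b := fun i => ⟨hu.1 i, hu.2 i⟩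
    have hC0 : ENNReal.ofReal (c⁻¹ ^ d * 2 ^ d) ≠ 0 := by
      simp only [ne_eq, ENNReal.ofReal_eq_zero, not_le]
      positivity
    by_cases hall : ∀ k, u ∈ dyadicBox a b θ v k
    · have : ∑' k, (dyadicBox a b θ v k).indicator (fun _ => ((2 : ℝ≥0∞) ^ d) ^ k) u = ⊤ := by
        refine top_le_iff.1 ?_
        calc (⊤ : ℝ≥0∞) = ∑' _ : ℕ, 1 := by simp
          _ ≤ _ := by
            refine ENNReal.tsum_le_tsum fun k => ?_
            rw [Set.indicator_of_mem (hall k)]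
            exact one_le_pow₀ (one_le_pow₀ one_le_two)
      rw [this, ENNReal.mul_top hC0]
      exact le_top
    · push Not at hall
      have h0 : u ∈ dyadicBox a b θ v 0 := by
        refine ⟨huI, fun i => ?_⟩
        rw [pow_zero]
        refine Real.rpow_le_one (abs_nonneg _) ?_ (hθ i).le
        rw [abs_le]
        constructor <;> linarith [(huI i).1, (huI i).2, (hv i).1, (hv i).2]
      obtain ⟨k, hk, hk1⟩ : ∃ k, u ∈ dyadicBox a b θ v k ∧ u ∉ dyadicBox a b θ v (k + 1) := by
        by_contra! hcon
        obtain ⟨n, hn⟩ := hall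
        exact hn (Nat.rec h0 (fun k ih => hcon k ih) n)
      have : ∃ i, (2⁻¹ : ℝ) ^ (k + 1) < |u i - v i| ^ θ i := by
        by_contra! hcon
        exact hk1 ⟨huI, hcon⟩
      obtain ⟨i, hi⟩ := this
      have h1 : ENNReal.ofReal (c * 2⁻¹ ^ (k + 1)) ≤ Ψ u :=
        (ENNReal.ofReal_le_ofReal (by gcongr)).trans (hΨ u huI i)
      calc Ψ u ^ (-(d : ℝ)) = (Ψ u ^ d)⁻¹ := by rw [ENNReal.rpow_neg, ENNReal.rpow_natCast]
        _ ≤ (ENNReal.ofReal (c * 2⁻¹ ^ (k + 1)) ^ d)⁻¹ := by gcongr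
        _ = ENNReal.ofReal (c⁻¹ ^ d * 2 ^ d) * ((2 : ℝ≥0∞) ^ d) ^ k := by
          have e : ((2 : ℝ≥0∞) ^ d) ^ k = ENNReal.ofReal ((2 ^ d) ^ k) := by
            rw [ENNReal.ofReal_pow (by positivity), ENNReal.ofReal_pow (by positivity)]
            simp
          rw [← ENNReal.ofReal_pow (by positivity), ← ENNReal.ofReal_inv_of_pos (by positivity), e,
            ← ENNReal.ofReal_mul (by positivity)]
          congr 1
          rw [← inv_pow, mul_inv, ← inv_pow, inv_inv, mul_pow, pow_succ, mul_pow, mul_assoc,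
            mul_comm ((2 ^ k) ^ d), pow_right_comm]
        _ ≤ _ := by
          gcongr
          refine le_trans (le_of_eq ?_) (ENNReal.le_tsum k)
          rw [Set.indicator_of_mem hk]
  refine (setLIntegral_mono' measurableSet_Icc hpt).trans ?_
  rw [lintegral_const_mul' _ _ ENNReal.ofReal_ne_top, lintegral_tsum_dyadicBox hθ]
  gcongr
  calc _ ≤ ∑' k : ℕ, ENNReal.ofReal (2 ^ N) *
        (((2 : ℝ≥0∞) ^ d) ^ k * ENNReal.ofReal (2 ^ (-∑ i, 1 / θ i)) ^ k) := by
        refine ENNReal.tsum_le_tsum fun k => ?_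
        rw [mul_left_comm]
        gcongr
        exact volume_dyadicBox_le hθ k
    _ = ENNReal.ofReal (2 ^ N) * (1 - ENNReal.ofReal (2 ^ (-(∑ i, 1 / θ i - d))))⁻¹ := by
        rw [ENNReal.tsum_mul_left, tsum_two_pow_mul_two_rpow]
    _ ≤ _ := by
        gcongr
        exact inv_one_sub_ofReal_two_rpow_neg_le hS

/-- Lower bound for a negative-moment integral of a function dominated by an anisotropic
distance. -/
lemma le_lintegral_rpow_neg {Ψ : (Fin N → ℝ) → ℝ≥0∞} {d : ℕ} (hd : 1 ≤ d) {C : ℝ} (hC : 0 < C)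
    (hθ : ∀ i, 0 < θ i) (hab : a < b) (hab1 : b - a ≤ 1) (hv : ∀ i, a ≤ v i ∧ v i ≤ b)
    (hΨ : ∀ u k, u ∈ dyadicBox a b θ v k → Ψ u ≤ ENNReal.ofReal (C * 2⁻¹ ^ k)) :
    ENNReal.ofReal ((b - a) ^ N) * (ENNReal.ofReal (∑ i, 1 / θ i - d))⁻¹ ≤
      2 * (ENNReal.ofReal (C ^ d) *
        ∫⁻ u in Set.Icc (fun _ : Fin N => a) (fun _ => b), Ψ u ^ (-(d : ℝ))) := by
  classical
  have hpt : ∀ u, ∑' k, (dyadicBox a b θ v k).indicator (fun _ => ((2 : ℝ≥0∞) ^ d) ^ k) u ≤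
      2 * (ENNReal.ofReal (C ^ d) * Ψ u ^ (-(d : ℝ))) := by
    intro u
    simp only [Set.indicator_apply]
    refine tsum_ite_pow_le (le_self_pow₀ one_le_two (by omega)) fun k hk => ?_
    rw [ENNReal.rpow_neg, ENNReal.rpow_natCast]
    calc ((2 : ℝ≥0∞) ^ d) ^ k
        = ENNReal.ofReal (C ^ d) * (ENNReal.ofReal (C * 2⁻¹ ^ k) ^ d)⁻¹ := by
          have e : ((2 : ℝ≥0∞) ^ d) ^ k = ENNReal.ofReal ((2 ^ d) ^ k) := by
            rw [ENNReal.ofReal_pow (by positivity), ENNReal.ofReal_pow (by positivity)]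
            simp
          rw [← ENNReal.ofReal_pow (by positivity), ← ENNReal.ofReal_inv_of_pos (by positivity), e,
            ← ENNReal.ofReal_mul (by positivity)]
          congr 1
          rw [mul_pow, mul_inv, ← mul_assoc, mul_inv_cancel₀ (by positivity), one_mul, ← inv_pow,
            ← inv_pow, inv_inv, ← pow_mul, ← pow_mul, mul_comm]
      _ ≤ _ := by
          gcongr
          exact hΨ u k hk
  calc _ ≤ ENNReal.ofReal ((b - a) ^ N) *
        (1 - ENNReal.ofReal (2 ^ (-(∑ i, 1 / θ i - d))))⁻¹ := by
        gcongr
        exact ENNReal.inv_le_inv.1 (by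
          simpa using inv_ofReal_le_inv_one_sub_ofReal_two_rpow_neg (∑ i, 1 / θ i - d))
    _ = ∑' k : ℕ, ENNReal.ofReal ((b - a) ^ N) *
        (((2 : ℝ≥0∞) ^ d) ^ k * ENNReal.ofReal (2 ^ (-∑ i, 1 / θ i)) ^ k) := by
        rw [ENNReal.tsum_mul_left, tsum_two_pow_mul_two_rpow]
    _ ≤ ∑' k, ((2 : ℝ≥0∞) ^ d) ^ k * volume (dyadicBox a b θ v k) := by
        refine ENNReal.tsum_le_tsum fun k => ?_
        rw [mul_left_comm]
        gcongr
        exact le_volume_dyadicBox hθ hab hab1 hv k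
    _ = ∫⁻ u in Set.Icc (fun _ : Fin N => a) (fun _ => b),
        ∑' k, (dyadicBox a b θ v k).indicator (fun _ => ((2 : ℝ≥0∞) ^ d) ^ k) u :=
        (lintegral_tsum_dyadicBox hθ d).symm
    _ ≤ ∫⁻ u in Set.Icc (fun _ : Fin N => a) (fun _ => b),
        2 * (ENNReal.ofReal (C ^ d) * Ψ u ^ (-(d : ℝ))) := lintegral_mono hpt
    _ = _ := by
        rw [lintegral_const_mul' _ _ (by simp), lintegral_const_mul' _ _ ENNReal.ofReal_ne_top]

end dyadicBox

lemma abs_sub_le_of_sum_min_le {N : ℕ} {h : Fin N → (Fin N → ℝ) → ℝ} {m M : Fin N → ℝ} {c r : ℝ}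
    {u v : Fin N → ℝ} {i : Fin N} (hc : 0 ≤ c) (hm : ∀ l, 0 < m l)
    (hH1 : ∀ l u, m l ≤ h l u ∧ h l u ≤ M l)
    (hH2 : |h i u - h i v| ≤ c * ∑ l, min (|u l - v l| ^ m l) (|u l - v l| ^ M l))
    (huv : ∀ l, |u l - v l| ≤ 1) (hr : ∀ l, |u l - v l| ^ h l v ≤ r) :
    |h i u - h i v| ≤ c * N * r := by
  refine hH2.trans ?_
  rw [mul_assoc]
  gcongr
  calc ∑ l, min (|u l - v l| ^ m l) (|u l - v l| ^ M l) ≤ ∑ _l : Fin N, r := by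
        refine sum_le_sum fun l _ => (min_le_right _ _).trans (le_trans ?_ (hr l))
        exact Real.rpow_le_rpow_of_exponent_ge' (abs_nonneg _) (huv l)
          ((hm l).le.trans (hH1 l v).1) (hH1 l v).2
    _ = N * r := by simp

lemma exp_neg_mul_rpow_le {x a b K m : ℝ} (hx0 : 0 < x) (hx1 : x ≤ 1) (hm : 0 < m) (hb : m ≤ b)
    (hK : 0 ≤ K) (hab : a ≤ b + K * x ^ b) : Real.exp (-(K / m)) * x ^ b ≤ x ^ a := by
  have hb0 : 0 < b := hm.trans_le hb
  have ht : 0 < x ^ b := Real.rpow_pos_of_pos hx0 b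
  have h1 : -1 ≤ x ^ b * (b * Real.log x) := by
    rw [← Real.log_rpow hx0]
    have := mul_le_mul_of_nonneg_left (Real.one_sub_inv_le_log_of_pos ht) ht.le
    rw [mul_sub, mul_inv_cancel₀ ht.ne'] at this
    linarith
  have h2 : -(1 / m) ≤ x ^ b * Real.log x := by
    have : -(1 / b) ≤ x ^ b * Real.log x := by
      rw [← neg_div, div_le_iff₀ hb0]
      linarith
    have : 1 / b ≤ 1 / m := one_div_le_one_div_of_le hm hb
    linarith
  calc Real.exp (-(K / m)) * x ^ b ≤ x ^ (K * x ^ b) * x ^ b := by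
        gcongr
        rw [Real.rpow_def_of_pos hx0]
        gcongr
        have := mul_le_mul_of_nonneg_left h2 hK
        calc -(K / m) = K * -(1 / m) := by ring
          _ ≤ K * (x ^ b * Real.log x) := this
          _ = _ := by ring
    _ = x ^ (b + K * x ^ b) := by rw [← Real.rpow_add hx0, add_comm]
    _ ≤ x ^ a := Real.rpow_le_rpow_of_exponent_ge hx0 hx1 hab

lemma exists_PhiNorm_le {N : ℕ} {α m₀ M₀ T c : ℝ} {h : Fin N → (Fin N → ℝ) → ℝ}
    (hα : 0 < α) (hm₀ : 0 < m₀) (hM₀ : M₀ < 1) (hT : 0 < T) (hc : 0 ≤ c)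
    (hh : ∀ l u, m₀ ≤ h l u ∧ h l u ≤ M₀) :
    ∃ C > 0, ∀ u v : Fin N → ℝ, (∀ i, 0 < u i ∧ u i ≤ T) → (∀ i, 0 < v i ∧ v i ≤ T) →
      ∀ r, 0 ≤ r → (∀ i, |u i - v i| ^ h i v ≤ r) → (∀ i, |h i u - h i v| ≤ c * r) →
        PhiNorm N α h u v ≤ ENNReal.ofReal (C * r) := by
  obtain ⟨C, hC, H⟩ := exists_lintegral_increment_le (N := N) hα hm₀ hM₀ hT hc
  refine ⟨C ^ (1 / α), Real.rpow_pos_of_pos hC _, fun u v hu hv r hr h1 h2 => ?_⟩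
  have := H (fun i => h i u) (fun i => h i v) u v (fun i => hh i u) (fun i => hh i v) hu hv r hr
    h1 h2
  calc PhiNorm N α h u v ≤ ENNReal.ofReal (C * r ^ α) ^ (1 / α) :=
        ENNReal.rpow_le_rpow this (by positivity)
    _ = ENNReal.ofReal (C ^ (1 / α) * r) := by
        rw [ENNReal.ofReal_rpow_of_nonneg (by positivity) (by positivity),
          Real.mul_rpow hC.le (by positivity), ← Real.rpow_mul hr, mul_one_div_cancel hα.ne',
          Real.rpow_one]

lemma PhiNorm_comm (N : ℕ) (α : ℝ) (h : Fin N → (Fin N → ℝ) → ℝ) (u v : Fin N → ℝ) :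
    PhiNorm N α h u v = PhiNorm N α h v u := by
  simp only [PhiNorm, abs_sub_comm]

lemma le_PhiNorm_of_lt {N : ℕ} {α ε : ℝ} {h : Fin N → (Fin N → ℝ) → ℝ} (hα : 0 < α)
    (hα2 : α ≤ 2) (hε : 0 < ε) (hh : ∀ l u, 0 < h l u ∧ h l u < 1) {u v : Fin N → ℝ}
    (hu : ∀ i, ε ≤ u i) {l : Fin N} (hvl : 0 < v l) (hlu : v l < u l) :
    ENNReal.ofReal (((min ε 1 ^ 2 / 2) ^ N) ^ (1 / α) * |u l - v l| ^ h l u) ≤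
      PhiNorm N α h u v := by
  have hx : 0 ≤ u l - v l := by linarith
  have hp : 0 < min ε 1 := lt_min hε one_pos
  have := le_lintegral_increment (η := fun i => h i u) (θ := fun i => h i v) hα hα2 hε
    (fun i => hh i u) hu hvl hlu
  calc _ = ENNReal.ofReal ((min ε 1 ^ 2 / 2) ^ N * (u l - v l) ^ (α * h l u)) ^ (1 / α) := by
        rw [ENNReal.ofReal_rpow_of_nonneg (by positivity) (by positivity),
          Real.mul_rpow (by positivity) (by positivity), ← Real.rpow_mul hx, abs_of_nonneg hx]
        congr 3
        field_simp
    _ ≤ PhiNorm N α h u v := ENNReal.rpow_le_rpow this (by positivity)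

lemma le_PhiNorm {N : ℕ} {α ε m₀ c : ℝ} {h : Fin N → (Fin N → ℝ) → ℝ} (hα : 0 < α)
    (hα2 : α ≤ 2) (hε : 0 < ε) (hm₀ : 0 < m₀) (hc : 0 ≤ c)
    (hh : ∀ l u, m₀ ≤ h l u ∧ h l u < 1) {u v : Fin N → ℝ}
    (hu : ∀ i, ε ≤ u i) (hv : ∀ i, ε ≤ v i) (huv : ∀ i, |u i - v i| ≤ 1)
    (hhuv : ∀ r, (∀ l, |u l - v l| ^ h l v ≤ r) → ∀ i, |h i u - h i v| ≤ c * r) (i : Fin N) :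
    ENNReal.ofReal (((min ε 1 ^ 2 / 2) ^ N) ^ (1 / α) * Real.exp (-(c / m₀)) *
      |u i - v i| ^ h i v) ≤ PhiNorm N α h u v := by
  have hh0 : ∀ l u, 0 < h l u ∧ h l u < 1 := fun l u => ⟨hm₀.trans_le (hh l u).1, (hh l u).2⟩
  have hp : 0 < min ε 1 := lt_min hε one_pos
  have : Nonempty (Fin N) := ⟨i⟩
  obtain ⟨l, hl⟩ := Finite.exists_max fun j => |u j - v j| ^ h j v
  suffices ENNReal.ofReal (((min ε 1 ^ 2 / 2) ^ N) ^ (1 / α) * (Real.exp (-(c / m₀)) *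
      |u l - v l| ^ h l v)) ≤ PhiNorm N α h u v by
    refine le_trans (ENNReal.ofReal_le_ofReal ?_) this
    rw [← mul_assoc]
    exact mul_le_mul_of_nonneg_left (hl i) (by positivity)
  rcases lt_trichotomy (u l) (v l) with hlt | heq | hlt
  · rw [PhiNorm_comm]
    refine le_trans (ENNReal.ofReal_le_ofReal ?_)
      (le_PhiNorm_of_lt hα hα2 hε hh0 hv (hε.trans_le (hu l)) hlt)
    rw [abs_sub_comm]
    gcongr
    refine mul_le_of_le_one_left (by positivity) (Real.exp_le_one_iff.2 ?_)
    rw [neg_nonpos]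
    positivity
  · simp [heq, Real.zero_rpow (hh0 l v).1.ne']
  · refine le_trans (ENNReal.ofReal_le_ofReal ?_)
      (le_PhiNorm_of_lt hα hα2 hε hh0 hu (hε.trans_le (hv l)) hlt)
    gcongr
    refine exp_neg_mul_rpow_le (abs_pos.2 (by linarith)) (huv l) hm₀ (hh l v).1 hc ?_
    have := (le_abs_self _).trans (hhuv _ hl l)
    linarith

/-- If `g` is continuous on a box and negative somewhere on it, the integral of `1 / g₊` over the
box is infinite. -/
lemma nonneg_of_lintegral_inv_ofReal_lt_top {N : ℕ} {a b : ℝ} (hab : a < b)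
    {g : (Fin N → ℝ) → ℝ} (hg : ContinuousOn g (Set.Icc (fun _ => a) (fun _ => b)))
    (hint : ∫⁻ v in Set.Icc (fun _ : Fin N => a) (fun _ => b), (ENNReal.ofReal (g v))⁻¹ < ⊤)
    {v₀ : Fin N → ℝ} (hv₀ : v₀ ∈ Set.Icc (fun _ : Fin N => a) (fun _ => b)) : 0 ≤ g v₀ := by
  by_contra! hlt
  obtain ⟨O, hO, hv₀O, hOI⟩ := mem_nhdsWithin.1 ((hg v₀ hv₀).eventually (gt_mem_nhds hlt))
  set P : Set (Fin N → ℝ) := Set.univ.pi fun _ => Set.Ioo a b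
  have hPI : P ⊆ Set.Icc (fun _ : Fin N => a) (fun _ => b) := fun x hx =>
    ⟨fun i => (hx i trivial).1.le, fun i => (hx i trivial).2.le⟩
  have hcl : v₀ ∈ closure P := by
    rw [closure_pi_set]
    intro i _
    rw [closure_Ioo hab.ne]
    exact ⟨hv₀.1 i, hv₀.2 i⟩
  have hPo : IsOpen (O ∩ P) := hO.inter (isOpen_set_pi Set.finite_univ fun _ _ => isOpen_Ioo)
  have hpos : 0 < volume (O ∩ P) := hPo.measure_pos _ (mem_closure_iff.1 hcl O hO hv₀O)
  refine hint.not_ge ?_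
  calc (⊤ : ℝ≥0∞) = ∫⁻ _v in O ∩ P, ⊤ := by
        rw [setLIntegral_const, ENNReal.top_mul hpos.ne']
    _ ≤ ∫⁻ v in O ∩ P, (ENNReal.ofReal (g v))⁻¹ := by
        refine setLIntegral_mono' hPo.measurableSet fun v hv => ?_
        have : g v < 0 := hOI ⟨hv.1, hPI hv.2⟩
        rw [ENNReal.ofReal_of_nonpos this.le, ENNReal.inv_zero]
    _ ≤ _ := lintegral_mono_set (Set.inter_subset_right.trans hPI)

lemma continuousOn_of_abs_sub_le_sum_min {N : ℕ} {f : (Fin N → ℝ) → ℝ} {m M : Fin N → ℝ} {c : ℝ}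
    {K : Set (Fin N → ℝ)} (hM : ∀ l, 0 < M l) (hc : 0 ≤ c)
    (hf : ∀ u ∈ K, ∀ v ∈ K,
      |f u - f v| ≤ c * ∑ l, min (|u l - v l| ^ m l) (|u l - v l| ^ M l)) :
    ContinuousOn f K := by
  intro v hv
  rw [ContinuousWithinAt, tendsto_iff_dist_tendsto_zero]
  have hlim : Filter.Tendsto (fun u : Fin N → ℝ => c * ∑ l, |u l - v l| ^ M l)
      (nhdsWithin v K) (nhds 0) := by
    have : Continuous fun u : Fin N → ℝ => c * ∑ l, |u l - v l| ^ M l := by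
      refine continuous_const.mul (continuous_finsetSum _ fun l _ => ?_)
      exact Continuous.rpow_const (by fun_prop) fun _ => Or.inr (hM l).le
    refine (this.tendsto' v 0 ?_).mono_left nhdsWithin_le_nhds
    simp [Real.zero_rpow (hM _).ne']
  refine squeeze_zero' (Filter.Eventually.of_forall fun _ => dist_nonneg) ?_ hlim
  filter_upwards [self_mem_nhdsWithin] with u hu
  rw [Real.dist_eq]
  refine (hf u hu v hv).trans ?_
  gcongr
  exact min_le_right _ _

/-- Theorem 2.1 (analytic content): for `I = [ε,T]^N` with `T - ε` small, the
energy integral `∫_I ∫_I Φ(u,v)^{-d} du dv` is finite iff condition `C` holds.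
The convention `0^{-d} = ∞` is realized by `ENNReal` arithmetic. -/
theorem energy_integral_finite_iff_condition_C (N : ℕ) (hN : 1 ≤ N)
    (d : ℕ) (hd : 1 ≤ d) (α : ℝ) (hα0 : 0 < α) (hα2 : α ≤ 2)
    (h : Fin N → (Fin N → ℝ) → ℝ) (m M : Fin N → ℝ)
    (hm : ∀ l, 0 < m l) (hmM : ∀ l, m l ≤ M l) (hM1 : ∀ l, M l < 1)
    (hH1 : ∀ l u, m l ≤ h l u ∧ h l u ≤ M l)
    (hH2 : ∀ K : Set (Fin N → ℝ), IsCompact K → ∃ c > 0, ∀ u ∈ K, ∀ v ∈ K, ∀ l,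
      |h l u - h l v| ≤ c * ∑ l', min (|u l' - v l'| ^ m l') (|u l' - v l'| ^ M l')) :
    ∃ δ₀ > (0 : ℝ), ∀ ε T : ℝ, 0 < ε → ε < T → T - ε ≤ δ₀ →
      ((∫⁻ v in Set.Icc (fun _ : Fin N => ε) (fun _ => T),
          ∫⁻ u in Set.Icc (fun _ : Fin N => ε) (fun _ => T),
            PhiNorm N α h u v ^ (-(d : ℝ))) < ⊤ ↔
        ((∀ v ∈ Set.Icc (fun _ : Fin N => ε) (fun _ => T), (d : ℝ) ≤ ∑ l, 1 / h l v) ∧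
          (∫⁻ v in Set.Icc (fun _ : Fin N => ε) (fun _ => T),
            (ENNReal.ofReal (∑ l, 1 / h l v - d))⁻¹) < ⊤)) := by
  refine ⟨1, one_pos, fun ε T hε hεT hT1 => ?_⟩
  have : Nonempty (Fin N) := ⟨⟨0, hN⟩⟩
  obtain ⟨l₀, hl₀⟩ := Finite.exists_min m
  obtain ⟨l₁, hl₁⟩ := Finite.exists_max M
  have hh : ∀ l u, m l₀ ≤ h l u ∧ h l u ≤ M l₁ := fun l u =>
    ⟨(hl₀ l).trans (hH1 l u).1, (hH1 l u).2.trans (hl₁ l)⟩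
  have hpos : ∀ l u, 0 < h l u := fun l u => (hm l₀).trans_le (hh l u).1
  set I := Set.Icc (fun _ : Fin N => ε) (fun _ => T)
  obtain ⟨c, hc, hcI⟩ := hH2 I isCompact_Icc
  have hT : 0 < T := hε.trans hεT
  have hIpos : ∀ u ∈ I, ∀ i, 0 < u i ∧ u i ≤ T := fun u hu i => ⟨hε.trans_le (hu.1 i), hu.2 i⟩
  have hIab : ∀ u ∈ I, ∀ v ∈ I, ∀ i, |u i - v i| ≤ 1 := fun u hu v hv i => by
    have := hu.1 i
    have := hu.2 i
    have := hv.1 i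
    have := hv.2 i
    rw [abs_le]
    constructor <;> linarith
  have hhI : ∀ u ∈ I, ∀ v ∈ I, ∀ r, (∀ l, |u l - v l| ^ h l v ≤ r) →
      ∀ i, |h i u - h i v| ≤ c * N * r := fun u hu v hv r hr i =>
    abs_sub_le_of_sum_min_le hc.le hm hH1 (hcI u hu v hv i) (hIab u hu v hv) hr
  obtain ⟨C, hC, hup⟩ := exists_PhiNorm_le (N := N) (c := c * N) hα0 (hm l₀) (hM1 l₁) hT
    (by positivity) hh
  set b := ((min ε 1 ^ 2 / 2) ^ N) ^ (1 / α) * Real.exp (-(c * N / m l₀))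
  have hb : 0 < b := by
    have hp : 0 < min ε 1 := lt_min hε one_pos
    positivity
  have hlow : ∀ u ∈ I, ∀ v ∈ I, ∀ i, ENNReal.ofReal (b * |u i - v i| ^ h i v) ≤
      PhiNorm N α h u v := fun u hu v hv i =>
    le_PhiNorm hα0 hα2 hε (hm l₀) (by positivity)
      (fun l u => ⟨(hh l u).1, (hh l u).2.trans_lt (hM1 l₁)⟩) hu.1 hv.1 (hIab u hu v hv)
      (hhI u hu v hv) i
  have hS : ∀ v, ∑ l, 1 / h l v - d ≤ ∑ _l : Fin N, 1 / m l₀ := fun v =>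
    (sub_le_self _ (Nat.cast_nonneg d)).trans
      (sum_le_sum fun l _ => one_div_le_one_div_of_le (hm l₀) (hh l v).1)
  have hle : ∀ v ∈ I, ENNReal.ofReal ((T - ε) ^ N) * (ENNReal.ofReal (∑ l, 1 / h l v - d))⁻¹ ≤
      2 * (ENNReal.ofReal (C ^ d) * ∫⁻ u in I, PhiNorm N α h u v ^ (-(d : ℝ))) := fun v hv =>
    le_lintegral_rpow_neg hd hC (fun l => hpos l v) hεT hT1 (fun i => ⟨hv.1 i, hv.2 i⟩)
      fun u k hu =>
        have huI : u ∈ I := ⟨fun i => (hu.1 i).1, fun i => (hu.1 i).2⟩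
        hup u v (hIpos u huI) (hIpos v hv) _ (by positivity) hu.2 (hhI u huI v hv _ hu.2)
  have hge := fun v (hv : v ∈ I) => lintegral_rpow_neg_le (d := d)
    (Ψ := fun u => PhiNorm N α h u v) hb (fun l => hpos l v) (hS v) hT1
    (fun i => ⟨hv.1 i, hv.2 i⟩) fun u hu => hlow u ⟨fun i => (hu i).1, fun i => (hu i).2⟩ v hv
  have hfin : (∫⁻ v in I, ∫⁻ u in I, PhiNorm N α h u v ^ (-(d : ℝ))) < ⊤ ↔
      (∫⁻ v in I, (ENNReal.ofReal (∑ l, 1 / h l v - d))⁻¹) < ⊤ := by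
    constructor <;> intro hlt
    · have := setLIntegral_mono' (μ := volume) measurableSet_Icc hle
      rw [lintegral_const_mul' _ _ ENNReal.ofReal_ne_top, lintegral_const_mul' _ _ (by simp),
        lintegral_const_mul' _ _ ENNReal.ofReal_ne_top] at this
      refine ENNReal.lt_top_of_mul_ne_top_right (ne_top_of_le_ne_top ?_ this) ?_
      · exact ENNReal.mul_ne_top (by simp) (ENNReal.mul_ne_top ENNReal.ofReal_ne_top hlt.ne)
      · have : 0 < T - ε := sub_pos.2 hεT
        exact (ENNReal.ofReal_pos.2 (by positivity)).ne'
    · refine (setLIntegral_mono' measurableSet_Icc hge).trans_lt ?_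
      rw [lintegral_const_mul' _ _ ENNReal.ofReal_ne_top,
        lintegral_const_mul' _ _ ENNReal.ofReal_ne_top,
        lintegral_const_mul' _ _ ENNReal.ofReal_ne_top]
      exact ENNReal.mul_lt_top ENNReal.ofReal_lt_top (ENNReal.mul_lt_top ENNReal.ofReal_lt_top
        (ENNReal.mul_lt_top ENNReal.ofReal_lt_top hlt))
  rw [hfin]
  refine ⟨fun hint => ⟨fun v hv => ?_, hint⟩, And.right⟩
  refine sub_nonneg.1 (nonneg_of_lintegral_inv_ofReal_lt_top
    (g := fun v => ∑ l, 1 / h l v - d) hεT ?_ hint hv)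
  refine (continuousOn_finsetSum _ fun l _ => ?_).sub continuousOn_const
  refine continuousOn_const.div ?_ fun v _ => (hpos l v).ne'
  exact continuousOn_of_abs_sub_le_sum_min (fun l => (hm l).trans_le (hmM l)) hc.le
    fun u hu v hv => hcI u hu v hv l
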